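/- arXiv:2509.20137 — 3 statements merged into one kernel-verified Lean document; each statement's English description precedes it below -/
import Mathlib

section
/- Let 𝒜 be an abelian category with enough projective objects and let M be an object of 𝒜 with finite projective dimension pd_𝒜(M) < ∞. Then qpd_𝒜(M) = pd_𝒜(M). -/
/-!
Quasi-projective dimension, following Gheibi–Jorgensen–Takahashi and
Chen–Chen–Liu, "Properties of quasi-projective dimension over abelian categories".
-/

open CategoryTheory CategoryTheory.Limits

attribute [local instance] CategoryTheory.Abelian.hasFiniteBiproducts

noncomputable section

universe v u

namespace QPD

variable {A : Type*} [Category A] [Abelian A]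

/-- The direct sum of `n` copies of `M`. -/
def copies (M : A) (n : ℕ) : A := ⨁ (fun _ : Fin n => M)

/-- `X` belongs to `add M`: it is a direct summand of a finite direct sum of copies of `M`. -/
def inAdd (M X : A) : Prop :=
  ∃ (n : ℕ) (s : X ⟶ copies M n) (r : copies M n ⟶ X), s ≫ r = 𝟙 X

/-- `P` is a quasi-projective resolution of `M`: a bounded-below complex of projective
objects whose `j`-th homology is a direct sum of `mult j` copies of `M`, where the
multiplicities `mult j` are not all zero. -/
structure IsQuasiProjRes (M : A) (P : ChainComplex A ℤ) : Prop where
  projective : ∀ i, Projective (P.X i)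
  bddBelow : ∃ a : ℤ, ∀ i, i < a → IsZero (P.X i)
  homology_iso : ∃ mult : ℤ → ℕ, (∃ j, mult j ≠ 0) ∧
    ∀ j, Nonempty (P.homology j ≅ copies M (mult j))

/-- `P` is a finite (i.e. bounded) quasi-projective resolution of `M`. -/
structure IsFiniteQuasiProjRes (M : A) (P : ChainComplex A ℤ) extends
    IsQuasiProjRes M P : Prop where
  bddAbove : ∃ b : ℤ, ∀ i, b < i → IsZero (P.X i)

/-- `s` is the supremum of the degrees in which `P` is nonzero. -/
def IsSup (P : ChainComplex A ℤ) (s : ℤ) : Prop :=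
  ¬ IsZero (P.X s) ∧ ∀ i, s < i → IsZero (P.X i)

/-- `t` is the supremum of the degrees in which the homology of `P` is nonzero. -/
def IsHSup (P : ChainComplex A ℤ) (t : ℤ) : Prop :=
  ¬ IsZero (P.homology t) ∧ ∀ i, t < i → IsZero (P.homology i)

/-- `t` is the infimum of the degrees in which the homology of `P` is nonzero. -/
def IsHInf (P : ChainComplex A ℤ) (t : ℤ) : Prop :=
  ¬ IsZero (P.homology t) ∧ ∀ i, i < t → IsZero (P.homology i)

open Classical in
/-- The quasi-projective dimension of `M`, as an element of `ℕ∞`: the infimum of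
`sup P• - hsup P•` over all finite quasi-projective resolutions `P•` of `M`
(it is `0` for the zero object and `⊤` if no finite quasi-projective resolution exists). -/
def qpd (M : A) : ℕ∞ :=
  if IsZero M then 0
  else sInf {d : ℕ∞ | ∃ (P : ChainComplex A ℤ) (s t : ℤ),
    IsFiniteQuasiProjRes M P ∧ IsSup P s ∧ IsHSup P t ∧ d = ((s - t).toNat : ℕ∞)}

/-- `M` admits a projective resolution of length at most `n`. -/
def pdLE (M : A) (n : ℕ) : Prop :=
  ∃ P : ChainComplex A ℤ, (∀ i, Projective (P.X i)) ∧
    (∀ i : ℤ, i < 0 → IsZero (P.X i)) ∧ (∀ i : ℤ, (n : ℤ) < i → IsZero (P.X i)) ∧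
    (∀ i : ℤ, i ≠ 0 → IsZero (P.homology i)) ∧ Nonempty (P.homology 0 ≅ M)

/-- The projective dimension of `M`, as an element of `ℕ∞`. -/
def pd (M : A) : ℕ∞ := sInf {d : ℕ∞ | ∃ n : ℕ, d = (n : ℕ∞) ∧ pdLE M n}

open Classical in
/-- Quasi-projective dimension computed using only complexes all of whose terms satisfy the
predicate `Q` (e.g. `Q` = "finitely generated", for the category of finitely presented
modules over a left coherent ring). -/
def qpdRel (Q : A → Prop) (M : A) : ℕ∞ :=
  if IsZero M then 0
  else sInf {d : ℕ∞ | ∃ (P : ChainComplex A ℤ) (s t : ℤ),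
    IsFiniteQuasiProjRes M P ∧ (∀ i, Q (P.X i)) ∧ IsSup P s ∧ IsHSup P t ∧
    d = ((s - t).toNat : ℕ∞)}

/-- Projective dimension computed using only resolutions all of whose terms satisfy the
predicate `Q`. -/
def pdRel (Q : A → Prop) (M : A) : ℕ∞ :=
  sInf {d : ℕ∞ | ∃ n : ℕ, d = (n : ℕ∞) ∧ ∃ P : ChainComplex A ℤ,
    (∀ i, Projective (P.X i)) ∧ (∀ i, Q (P.X i)) ∧
    (∀ i : ℤ, i < 0 → IsZero (P.X i)) ∧ (∀ i : ℤ, (n : ℤ) < i → IsZero (P.X i)) ∧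
    (∀ i : ℤ, i ≠ 0 → IsZero (P.homology i)) ∧ Nonempty (P.homology 0 ≅ M)}

/-- Vanishing of the `n`-th Ext group, `Ext_𝒜^n(M, N) = 0`. -/
def extIsZero [EnoughProjectives A] (M N : A) (n : ℕ) : Prop :=
  IsZero (((_root_.Ext ℤ A n).obj (Opposite.op M)).obj N)

/-- The quasi-projective dimension of a finitely presented module over a (left coherent)
ring, computed inside the abelian category of finitely presented modules, i.e. via bounded
complexes of finitely generated projective modules. -/
def qpdFG {R : Type u} [Ring R] (M : ModuleCat.{u} R) : ℕ∞ :=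
  qpdRel (fun N : ModuleCat.{u} R => Module.Finite R N) M

/-- The projective dimension of a finitely presented module over a (left coherent) ring,
computed inside the abelian category of finitely presented modules. -/
def pdFG {R : Type u} [Ring R] (M : ModuleCat.{u} R) : ℕ∞ :=
  pdRel (fun N : ModuleCat.{u} R => Module.Finite R N) M

/-- A ring is left coherent if every finitely generated left ideal is finitely presented. -/
def IsLeftCoherent (R : Type u) [Ring R] : Prop :=
  ∀ I : Ideal R, I.FG → Module.FinitePresentation R I

/-- The quasi-global dimension of a ring: the supremum of the quasi-projective dimensions
of all finitely generated left modules. -/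
def qgldim (R : Type u) [Ring R] : ℕ∞ :=
  sSup {d : ℕ∞ | ∃ M : ModuleCat.{u} R, Module.Finite R M ∧ d = qpd M}

/-- The global dimension of a ring: the supremum of the projective dimensions of all
finitely generated left modules. -/
def gldim (R : Type u) [Ring R] : ℕ∞ :=
  sSup {d : ℕ∞ | ∃ M : ModuleCat.{u} R, Module.Finite R M ∧ d = pd M}

/-- The finitistic dimension of a ring: the supremum of the projective dimensions of all
finitely generated left modules of finite projective dimension. -/
def findim (R : Type u) [Ring R] : ℕ∞ :=
  sSup {d : ℕ∞ | ∃ M : ModuleCat.{u} R, Module.Finite R M ∧ d = pd M ∧ pd M ≠ ⊤}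

/-- The depth of a module over a Noetherian local ring:
`depth M = inf {i : Ext^i(R/𝔪, M) ≠ 0}`. -/
def depth {R : Type u} [CommRing R] [IsLocalRing R] (M : ModuleCat.{u} R) : ℕ∞ :=
  sInf {d : ℕ∞ | ∃ n : ℕ, d = (n : ℕ∞) ∧
    ¬ IsZero (((_root_.Ext ℤ (ModuleCat.{u} R) n).obj
      (Opposite.op (ModuleCat.of R (IsLocalRing.ResidueField R)))).obj M)}

end QPD

end

noncomputable section

namespace HomologicalComplex

variable {C ι : Type*} [Category C] [Abelian C] {c : ComplexShape ι}
  (K : HomologicalComplex C c) {i j : ι}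

/-- The short complex `im (d i j) ⟶ K.X j ⟶ K.opcycles j`. -/
abbrev imageOpcyclesShortComplex (i j : ι) : ShortComplex C :=
  ShortComplex.mk (image.ι (K.d i j)) (K.pOpcycles j)
    (by simp [← cancel_epi (factorThruImage (K.d i j))])

lemma imageOpcyclesShortComplex_shortExact (hij : c.Rel i j) :
    (K.imageOpcyclesShortComplex i j).ShortExact := by
  let S := ShortComplex.mk (K.d i j) (K.pOpcycles j) (K.d_pOpcycles i j)
  let φ : S ⟶ K.imageOpcyclesShortComplex i j :=
    { τ₁ := factorThruImage (K.d i j)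
      τ₂ := 𝟙 _
      τ₃ := 𝟙 _ }
  have : Epi φ.τ₁ := by dsimp [φ]; infer_instance
  have : IsIso φ.τ₂ := by dsimp [φ]; infer_instance
  have : Mono φ.τ₃ := by dsimp [φ]; infer_instance
  exact
    { exact := (ShortComplex.exact_iff_of_epi_of_isIso_of_mono φ).1
        (S.exact_of_g_is_cokernel (K.opcyclesIsCokernel i j (c.prev_eq' hij)))
      mono_f := inferInstance
      epi_g := inferInstance }

/-- The short complex `K.homology i ⟶ K.opcycles i ⟶ im (d i j)`. -/
abbrev homologyImageShortComplex (i j : ι) : ShortComplex C :=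
  ShortComplex.mk (K.homologyι i)
    (K.descOpcycles (factorThruImage (K.d i j)) (c.prev i) rfl
      (by simp [← cancel_mono (image.ι (K.d i j))]))
    (by simp [← cancel_mono (image.ι (K.d i j)), descOpcycles_comp,
      K.homologyι_descOpcycles_eq_zero_of_boundary (K.d i j) _ rfl (𝟙 _)])

lemma homologyImageShortComplex_shortExact (hij : c.Rel i j) :
    (K.homologyImageShortComplex i j).ShortExact := by
  let S := ShortComplex.mk (K.homologyι i) (K.fromOpcycles i j) (by simp)
  let φ : K.homologyImageShortComplex i j ⟶ S :=
    { τ₁ := 𝟙 _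
      τ₂ := 𝟙 _
      τ₃ := image.ι (K.d i j)
      comm₂₃ := by simp [S, ← cancel_epi (K.pOpcycles i)] }
  have : Epi φ.τ₁ := by dsimp [φ]; infer_instance
  have : IsIso φ.τ₂ := by dsimp [φ]; infer_instance
  have : Mono φ.τ₃ := by dsimp [φ]; infer_instance
  exact
    { exact := (ShortComplex.exact_iff_of_epi_of_isIso_of_mono φ).2
        (S.exact_of_f_is_kernel (K.homologyIsKernel i j (c.next_eq' hij)))
      mono_f := inferInstance
      epi_g := by
        exact epi_of_epi_fac (K.p_descOpcycles (factorThruImage (K.d i j)) _ rfl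
          (by simp [← cancel_mono (image.ι (K.d i j))])) }

lemma isZero_homology_of_isZero_X (hi : IsZero (K.X i)) : IsZero (K.homology i) :=
  (ExactAt.of_isZero hi).isZero_homology

end HomologicalComplex

namespace ComplexShape

/-- The embedding of `up ℕ` into `down ℤ` whose image consists of the degrees `≤ p`. -/
def embeddingDownIntLE (p : ℤ) : Embedding (up ℕ) (down ℤ) :=
  Embedding.mk' _ _ (fun n => p - n)
    (fun _ _ h => by lia)
    (fun _ _ => by simp only [up_Rel, down_Rel]; lia)

lemma embeddingDownIntLE_f (p : ℤ) (n : ℕ) : (embeddingDownIntLE p).f n = p - n := rfl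

instance (p : ℤ) : (embeddingDownIntLE p).IsTruncGE where
  rel' i j h := by
    simp only [embeddingDownIntLE_f, down_Rel, up_Rel] at h ⊢
    lia
  mem_next {j k} h := ⟨j + 1, by
    simp only [embeddingDownIntLE_f, down_Rel] at h ⊢
    lia⟩

lemma eq_zero_of_boundaryGE_embeddingDownIntLE {p : ℤ} {n : ℕ}
    (h : (embeddingDownIntLE p).BoundaryGE n) : n = 0 := by
  obtain _ | n := n
  · rfl
  · exact absurd h (Embedding.not_boundaryGE_next _ rfl)

end ComplexShape

namespace QPD

variable {A : Type*} [Category A] [Abelian A]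

/-- If `P.opcycles m` is projective, the truncation of a complex of projectives `P` in degrees
`≤ m` consists of projectives. -/
lemma projective_truncGE_X (P : ChainComplex A ℤ) (hP : ∀ i, Projective (P.X i)) (m : ℤ)
    (hm : Projective (P.opcycles m)) (i : ℤ) :
    Projective ((P.truncGE (ComplexShape.embeddingDownIntLE m)).X i) := by
  by_cases hi : ∃ n, (ComplexShape.embeddingDownIntLE m).f n = i
  · obtain ⟨n, hn⟩ := hi
    by_cases hb : (ComplexShape.embeddingDownIntLE m).BoundaryGE n
    · obtain rfl := ComplexShape.eq_zero_of_boundaryGE_embeddingDownIntLE hb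
      obtain rfl : m = i := by simpa [ComplexShape.embeddingDownIntLE_f] using hn
      exact Projective.of_iso (P.truncGEXIsoOpcycles _ hn hb).symm hm
    · exact Projective.of_iso (P.truncGEXIso _ hn hb).symm (hP i)
  · exact (HomologicalComplex.isZero_extend_X _ _ _ (by simpa using hi)).projective

lemma hasProjectiveDimensionLT_opcycles (P : ChainComplex A ℤ) (hP : ∀ i, Projective (P.X i))
    (hneg : ∀ i : ℤ, i < 0 → IsZero (P.X i)) (hH : ∀ i : ℤ, i ≠ 0 → IsZero (P.homology i))
    (i k : ℕ) (h : HasProjectiveDimensionLT (P.homology 0) (i + k + 1)) :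
    HasProjectiveDimensionLT (P.opcycles (i : ℤ)) (k + 1) := by
  induction i generalizing k with
  | zero =>
    have hS := P.homologyImageShortComplex_shortExact (i := 0) (j := -1) (by simp)
    refine hS.hasProjectiveDimensionLT_X₂ (k + 1) (by simpa using h) ?_
    have hz : IsZero (image (P.d 0 (-1))) :=
      IsZero.of_mono (image.ι _) (hneg _ (by simp))
    have := hz.hasProjectiveDimensionLT_zero
    exact hasProjectiveDimensionLT_of_ge (image (P.d 0 (-1))) 0 _ (by simp)
  | succ i ih =>
    have ih := ih (k + 1) (by convert h using 1; lia)
    have hrel : (ComplexShape.down ℤ).Rel ((i + 1 : ℕ) : ℤ) (i : ℤ) := by simp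
    have hX := hP i
    have h1 := (P.imageOpcyclesShortComplex_shortExact hrel).hasProjectiveDimensionLT_X₁ (k + 1)
      (hasProjectiveDimensionLT_of_ge (P.X i) 1 _ (by simp)) ih
    have h0 := (hH ((i + 1 : ℕ) : ℤ) (by lia)).hasProjectiveDimensionLT_zero
    exact (P.homologyImageShortComplex_shortExact hrel).hasProjectiveDimensionLT_X₂ (k + 1)
      (hasProjectiveDimensionLT_of_ge (P.homology ((i + 1 : ℕ) : ℤ)) 0 _ (by simp)) h1

lemma pdLE.of_hasProjectiveDimensionLE {M : A} {n : ℕ} (h : pdLE M n) (m : ℕ)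
    (hM : HasProjectiveDimensionLE M m) : pdLE M m := by
  obtain ⟨P, hP, hneg, -, hH, ⟨e⟩⟩ := h
  have hop : Projective (P.opcycles (m : ℤ)) := by
    rw [projective_iff_hasProjectiveDimensionLT_one]
    exact hasProjectiveDimensionLT_opcycles P hP hneg hH m 0
      (hasProjectiveDimensionLT_of_iso e.symm _)
  let E := ComplexShape.embeddingDownIntLE m
  have hmem (i : ℤ) (hi : i ≤ m) : E.f (m - i).toNat = i := by
    simp only [E, ComplexShape.embeddingDownIntLE_f]; lia
  have hgt (i : ℤ) (hi : m < i) : IsZero ((P.truncGE E).X i) :=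
    HomologicalComplex.isZero_extend_X _ _ _ fun n ↦ by
      simp only [E, ComplexShape.embeddingDownIntLE_f]; lia
  have iso (i : ℤ) (hi : i ≤ m) : Nonempty (P.homology i ≅ (P.truncGE E).homology i) := by
    have := P.quasiIsoAt_πTruncGE E (hmem i hi)
    exact ⟨isoOfQuasiIsoAt (P.πTruncGE E) i⟩
  refine ⟨P.truncGE E, projective_truncGE_X P hP m hop, fun i hi ↦ ?_, hgt, fun i hi ↦ ?_, ?_⟩
  · have hb : ¬ E.BoundaryGE (m - i).toNat := fun hb ↦ by
      have := ComplexShape.eq_zero_of_boundaryGE_embeddingDownIntLE hb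
      lia
    exact (hneg i hi).of_iso (P.truncGEXIso E (hmem i (by lia)) hb)
  · by_cases him : i ≤ m
    · obtain ⟨e'⟩ := iso i him
      exact (hH i hi).of_iso e'.symm
    · exact HomologicalComplex.isZero_homology_of_isZero_X _ (hgt i (by lia))
  · obtain ⟨e'⟩ := iso 0 (by simp)
    exact ⟨e'.symm ≪≫ e⟩

lemma hasProjectiveDimensionLT_copies (M : A) (k n : ℕ) [HasProjectiveDimensionLT M n] :
    HasProjectiveDimensionLT (copies M k) n := by
  let := HasExt.standard A
  rw [hasProjectiveDimensionLT_iff]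
  intro i hi Y e
  apply (Abelian.Ext.biproductAddEquiv (biproduct.isBilimit _) Y i).injective
  ext j
  exact Abelian.Ext.eq_zero_of_hasProjectiveDimensionLT _ n hi |>.trans
    (Abelian.Ext.eq_zero_of_hasProjectiveDimensionLT _ n hi).symm

lemma isZero_copies_zero (M : A) : IsZero (copies M 0) := by
  rw [IsZero.iff_id_eq_zero]
  exact biproduct.hom_ext _ _ fun j ↦ j.elim0

/-- `M` is a retract of any nonempty direct sum of copies of `M`. -/
def copiesRetract (M : A) {k : ℕ} (hk : k ≠ 0) : Retract M (copies M k) where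
  i := biproduct.ι (fun _ : Fin k ↦ M) ⟨0, Nat.pos_of_ne_zero hk⟩
  r := biproduct.π (fun _ : Fin k ↦ M) ⟨0, Nat.pos_of_ne_zero hk⟩
  retract := biproduct.ι_π_self _ _

/-- The direct sum of one copy of `M` is `M`. -/
def copiesOneIso (M : A) : copies M 1 ≅ M :=
  biproductUniqueIso (fun _ : Fin 1 ↦ M)

lemma hasProjectiveDimensionLT_image_d (P : ChainComplex A ℤ) (hP : ∀ i, Projective (P.X i))
    {a : ℤ} (ha : ∀ i, i < a → IsZero (P.X i)) (n : ℕ)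
    (hH : ∀ i, HasProjectiveDimensionLT (P.homology i) (n + 2)) (i : ℤ) :
    HasProjectiveDimensionLT (image (P.d (i + 1) i)) (n + 1) := by
  have hlow (i : ℤ) (hi : i < a) : HasProjectiveDimensionLT (image (P.d (i + 1) i)) (n + 1) := by
    have := (IsZero.of_mono (image.ι (P.d (i + 1) i)) (ha i hi)).hasProjectiveDimensionLT_zero
    exact hasProjectiveDimensionLT_of_ge _ 0 _ (by simp)
  obtain hi | hi := lt_or_ge i a
  · exact hlow i hi
  · obtain ⟨k, rfl⟩ := Int.le.dest hi
    clear hi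
    have key (j : ℤ) (hj : HasProjectiveDimensionLT (image (P.d (j + 1) j)) (n + 1)) :
        HasProjectiveDimensionLT (image (P.d (j + 1 + 1) (j + 1))) (n + 1) := by
      have h2 := (P.homologyImageShortComplex_shortExact
        (i := j + 1) (j := j) rfl).hasProjectiveDimensionLT_X₂ (n + 2) (hH (j + 1))
        (hasProjectiveDimensionLT_of_ge (image (P.d (j + 1) j)) (n + 1) _ (by simp))
      have hX := hP (j + 1)
      exact (P.imageOpcyclesShortComplex_shortExact
        (i := j + 1 + 1) (j := j + 1) rfl).hasProjectiveDimensionLT_X₁ (n + 1)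
        (hasProjectiveDimensionLT_of_ge (P.X (j + 1)) 1 _ (by simp)) h2
    induction k with
    | zero =>
      have := key (a - 1) (hlow _ (by simp))
      rwa [sub_add_cancel, ← add_zero a] at this
    | succ k ih =>
      have := key _ ih
      rw [add_assoc a] at this
      exact_mod_cast this

lemma hasProjectiveDimensionLT_image_d_of_exact (P : ChainComplex A ℤ)
    (hP : ∀ i, Projective (P.X i)) {s t : ℤ} (hs : ∀ i, s < i → IsZero (P.X i))
    (ht : ∀ i, t < i → IsZero (P.homology i)) (k : ℕ) (i : ℤ) (hi : t ≤ i) (hik : s ≤ i + k) :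
    HasProjectiveDimensionLT (image (P.d (i + 1) i)) k := by
  induction k generalizing i with
  | zero =>
    exact (IsZero.of_epi (factorThruImage (P.d (i + 1) i))
      (hs _ (by lia))).hasProjectiveDimensionLT_zero
  | succ k ih =>
    have h1 := ih (i + 1) (by lia) (by lia)
    have hX := hP (i + 1)
    have h2 := (P.imageOpcyclesShortComplex_shortExact
      (i := i + 1 + 1) (j := i + 1) rfl).hasProjectiveDimensionLT_X₃ k h1
      (hasProjectiveDimensionLT_of_ge (P.X (i + 1)) 1 _ (by simp))
    have h0 := (ht (i + 1) (by lia)).hasProjectiveDimensionLT_zero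
    exact (P.homologyImageShortComplex_shortExact
      (i := i + 1) (j := i) rfl).hasProjectiveDimensionLT_X₃ k
      (hasProjectiveDimensionLT_of_ge (P.homology (i + 1)) 0 _ (by simp)) h2

lemma hasProjectiveDimensionLT_homology (P : ChainComplex A ℤ)
    (hP : ∀ i, Projective (P.X i)) {a s t : ℤ} (ha : ∀ i, i < a → IsZero (P.X i))
    (hs : ∀ i, s < i → IsZero (P.X i)) (ht : ∀ i, t < i → IsZero (P.homology i)) (n : ℕ)
    (hst : s ≤ t + n) (hH : ∀ i, HasProjectiveDimensionLT (P.homology i) (n + 2)) :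
    HasProjectiveDimensionLT (P.homology t) (n + 1) := by
  have h1 := hasProjectiveDimensionLT_image_d_of_exact P hP hs ht n t le_rfl hst
  have hX := hP t
  have h2 := (P.imageOpcyclesShortComplex_shortExact
    (i := t + 1) (j := t) rfl).hasProjectiveDimensionLT_X₃ n h1
    (hasProjectiveDimensionLT_of_ge (P.X t) 1 _ (by simp))
  have h3 := hasProjectiveDimensionLT_image_d P hP ha n hH (t - 1)
  rw [sub_add_cancel] at h3
  exact (P.homologyImageShortComplex_shortExact
    (i := t) (j := t - 1) (by simp)).hasProjectiveDimensionLT_X₁ (n + 1) h2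
    (hasProjectiveDimensionLT_of_ge (image (P.d t (t - 1))) (n + 1) _ (by simp))

lemma pdLE.hasProjectiveDimensionLE {M : A} {n : ℕ} (h : pdLE M n) :
    HasProjectiveDimensionLE M n := by
  obtain ⟨P, hP, hneg, hn, hH, ⟨e⟩⟩ := h
  have h1 := hasProjectiveDimensionLT_image_d_of_exact P hP hn
    (t := 0) (fun i hi ↦ hH i hi.ne') n 0 le_rfl (by simp)
  have hX := hP 0
  have h2 := (P.imageOpcyclesShortComplex_shortExact
    (i := 0 + 1) (j := 0) rfl).hasProjectiveDimensionLT_X₃ n h1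
    (hasProjectiveDimensionLT_of_ge (P.X 0) 1 _ (by simp))
  have hz : IsZero (image (P.d 0 (-1))) := IsZero.of_mono (image.ι _) (hneg _ (by simp))
  have h3 := hz.hasProjectiveDimensionLT_zero
  have h4 : HasProjectiveDimensionLT (P.homology 0) (n + 1) :=
    (P.homologyImageShortComplex_shortExact
      (i := 0) (j := -1) (by simp)).hasProjectiveDimensionLT_X₁ (n + 1) h2
      (hasProjectiveDimensionLT_of_ge (image (P.d 0 (-1))) 0 _ (by simp))
  exact hasProjectiveDimensionLT_of_iso (X := P.homology 0) e (n + 1)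

lemma pd_le_of_pdLE {M : A} {n : ℕ} (h : pdLE M n) : pd M ≤ n :=
  sInf_le ⟨n, rfl, h⟩

lemma exists_pd_eq_of_lt_top {M : A} (h : pd M < ⊤) : ∃ n : ℕ, pd M = n ∧ pdLE M n := by
  have hne : {d : ℕ∞ | ∃ n : ℕ, d = (n : ℕ∞) ∧ pdLE M n}.Nonempty := by
    by_contra! hempty
    rw [pd, hempty, sInf_empty] at h
    exact h.ne rfl
  exact csInf_mem hne

lemma pd_eq_zero_of_isZero {M : A} (hM : IsZero M) : pd M = 0 := by
  let Z : ChainComplex A ℤ := HomologicalComplex.zero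
  have hX (i : ℤ) : IsZero (Z.X i) := isZero_zero A
  have hH (i : ℤ) : IsZero (Z.homology i) :=
    HomologicalComplex.isZero_homology_of_isZero_X _ (hX i)
  have : pdLE M 0 := ⟨Z, fun i ↦ (hX i).projective, fun i _ ↦ hX i, fun i _ ↦ hX i,
    fun i _ ↦ hH i, ⟨(hH 0).iso hM⟩⟩
  simpa using pd_le_of_pdLE this

lemma qpd_le_of_pdLE {M : A} {n : ℕ} (h : pdLE M n) : qpd M ≤ n := by
  by_cases hM : IsZero M
  · simp [qpd, hM]
  rw [qpd, if_neg hM]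
  obtain ⟨P, hP, hneg, hn, hH, ⟨e⟩⟩ := h
  have hH0 : ¬ IsZero (P.homology 0) := fun h0 ↦ hM (h0.of_iso e.symm)
  obtain ⟨s, hs, hmax⟩ := Int.exists_greatest_of_bdd (P := fun i ↦ ¬ IsZero (P.X i))
    ⟨n, fun i hi ↦ by by_contra! hni; exact hi (hn i hni)⟩
    ⟨0, fun h0 ↦ hH0 (P.isZero_homology_of_isZero_X h0)⟩
  have hsn : s ≤ n := by
    by_contra! hns
    exact hs (hn s hns)
  refine sInf_le_of_le (b := ((s - 0).toNat : ℕ∞))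
    ⟨P, s, 0, ⟨⟨hP, ⟨0, hneg⟩, fun i ↦ if i = 0 then 1 else 0, ⟨0, by simp⟩, fun j ↦ ?_⟩, n, hn⟩,
      ⟨hs, fun i hi ↦ ?_⟩, ⟨hH0, fun i hi ↦ hH i hi.ne'⟩, rfl⟩ ?_
  · by_cases hj : j = 0
    · subst hj
      exact ⟨e ≪≫ (copiesOneIso M).symm⟩
    · simp only [if_neg hj]
      exact ⟨(hH j hj).iso (isZero_copies_zero M)⟩
  · by_contra hi'
    exact (hmax i hi').not_gt hi
  · exact_mod_cast (by lia : (s - 0).toNat ≤ n)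

lemma IsQuasiProjRes.pd_le {M : A} (hpd : pd M < ⊤) {P : ChainComplex A ℤ}
    (hP : IsQuasiProjRes M P) {s t : ℤ} (hs : IsSup P s) (ht : IsHSup P t) :
    pd M ≤ ((s - t).toNat : ℕ∞) := by
  obtain ⟨n, hn, hMn⟩ := exists_pd_eq_of_lt_top hpd
  rw [hn]
  by_contra! hlt
  replace hlt : (s - t).toNat < n := by exact_mod_cast hlt
  obtain ⟨mult, -, hmult⟩ := hP.homology_iso
  obtain ⟨a, ha⟩ := hP.bddBelow
  obtain ⟨n, rfl⟩ := Nat.exists_eq_succ_of_ne_zero (Nat.ne_zero_of_lt hlt)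
  have hM : HasProjectiveDimensionLT M (n + 2) := hMn.hasProjectiveDimensionLE
  have hH (i : ℤ) : HasProjectiveDimensionLT (P.homology i) (n + 2) := by
    have := hasProjectiveDimensionLT_copies M (mult i) (n + 2)
    exact hasProjectiveDimensionLT_of_iso (hmult i).some.symm _
  have hHt := hasProjectiveDimensionLT_homology P hP.projective ha hs.2 ht.2 n (by lia) hH
  obtain ⟨e⟩ := hmult t
  have hmt : mult t ≠ 0 := fun h0 ↦ by
    rw [h0] at e
    exact ht.1 ((isZero_copies_zero M).of_iso e)
  have := hasProjectiveDimensionLT_of_iso e (n + 1)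
  have hM' : HasProjectiveDimensionLE M n := (copiesRetract M hmt).hasProjectiveDimensionLT (n + 1)
  have hle := pd_le_of_pdLE (hMn.of_hasProjectiveDimensionLE n hM')
  rw [hn] at hle
  have : n + 1 ≤ n := by exact_mod_cast hle
  lia

end QPD

end

open QPD in
/-- If `M` has finite projective dimension, then its quasi-projective
dimension equals its projective dimension. -/
theorem qpd_eq_pd_of_pd_lt_top {A : Type*} [Category A] [Abelian A] [EnoughProjectives A]
    (M : A) (h : pd M < ⊤) : qpd M = pd M := by
  by_cases hM : IsZero M
  · rw [pd_eq_zero_of_isZero hM, qpd, if_pos hM]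
  apply le_antisymm
  · obtain ⟨n, hn, hMn⟩ := exists_pd_eq_of_lt_top h
    rw [hn]
    exact qpd_le_of_pdLE hMn
  · rw [qpd, if_neg hM]
    refine le_sInf ?_
    rintro d ⟨P, s, t, hP, hs, ht, rfl⟩
    exact hP.toIsQuasiProjRes.pd_le h hs ht
end

section
/- Let 𝒜 be an abelian category with enough projective objects, let M be an object of 𝒜, and let P• be a finite quasi-projective resolution of M with hsup(P•) = 0; set N := Coker(d_1 : P_1 → P_0). Let F : 𝒜 → ℬ be a right exact covariant additive functor to an abelian category ℬ, let L_iF denote its i-th left derived functor, and set d := sup{i ≥ 0 : L_iF(M) ≠ 0}. If 0 ≤ d < ∞, then d = sup{i ≥ 0 : L_iF(N) ≠ 0}; if moreover 0 < d < ∞, then L_dF(H_0(P•)) ≅ L_dF(N). -/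
/-!
Quasi-projective dimension, following Gheibi–Jorgensen–Takahashi and
Chen–Chen–Liu, "Properties of quasi-projective dimension over abelian categories".
-/

open CategoryTheory CategoryTheory.Limits

attribute [local instance] CategoryTheory.Abelian.hasFiniteBiproducts

noncomputable section

namespace CategoryTheory

lemma exists_mono_of_iso {C : Type*} [Category C] {X Y Z X' Y' Z' : C}
    (e₁ : X ≅ X') (e₂ : Y ≅ Y') (e₃ : Z ≅ Z')
    (h : ∃ f : X ⟶ Y, Mono f ∧ (IsZero Z → IsIso f)) :
    ∃ f : X' ⟶ Y', Mono f ∧ (IsZero Z' → IsIso f) := by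
  obtain ⟨f, hf, hf'⟩ := h
  refine ⟨e₁.inv ≫ f ≫ e₂.hom, inferInstance, fun hZ => ?_⟩
  have := hf' (hZ.of_iso e₃)
  infer_instance

end CategoryTheory

namespace CategoryTheory.ShortComplex

variable {C : Type*} [Category C] [Abelian C]

/-- If `p : S.X₂ ⟶ Q` is a cokernel of `S.f` and `S.g = p ≫ u`, then the homology of `S`
is the kernel of `u`. -/
def homologyIsoKernelOfIsColimit (S : ShortComplex C) {Q : C} (p : S.X₂ ⟶ Q)
    (wp : S.f ≫ p = 0) (hp : IsColimit (CokernelCofork.ofπ p wp)) (u : Q ⟶ S.X₃)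
    (hu : p ≫ u = S.g) : S.homology ≅ kernel u :=
  have hdesc : u = hp.desc (CokernelCofork.ofπ S.g S.zero) :=
    Cofork.IsColimit.hom_ext hp (hu.trans (hp.fac (CokernelCofork.ofπ S.g S.zero) .one).symm)
  RightHomologyData.homologyIso
    { Q := Q
      H := kernel (hp.desc (CokernelCofork.ofπ S.g S.zero))
      p := p
      ι := kernel.ι _
      wp := wp
      hp := hp
      wι := kernel.condition _
      hι := kernelIsKernel _ } ≪≫ kernelIsoOfEq hdesc.symm

end CategoryTheory.ShortComplex

namespace CategoryTheory.ProjectiveResolution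

variable {A : Type*} [Category A] [Abelian A]

/-- The augmentation of a projective resolution, as a morphism in the category. -/
def augmentation {X : A} (R : ProjectiveResolution X) : R.complex.X 0 ⟶ X := R.π.f 0

instance {X : A} (R : ProjectiveResolution X) : Epi R.augmentation :=
  inferInstanceAs (Epi (R.π.f 0))

lemma d_augmentation {X : A} (R : ProjectiveResolution X) :
    R.complex.d 1 0 ≫ R.augmentation = 0 :=
  R.complex_d_comp_π_f_zero

lemma exact_augmentation {X : A} (R : ProjectiveResolution X) :
    (ShortComplex.mk _ _ R.d_augmentation).Exact :=
  ShortComplex.exact_of_g_is_cokernel _ R.isColimitCokernelCofork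

variable {S : ShortComplex A}

/-- The complex obtained from a resolution of `S.X₁` by adding `S.X₂` in degree `0`. -/
abbrev spliceComplex (S : ShortComplex A) (R : ProjectiveResolution S.X₁) : ChainComplex A ℕ :=
  R.complex.augment (R.augmentation ≫ S.f) (by
    rw [← Category.assoc, R.d_augmentation, zero_comp])

/-- The augmentation of `spliceComplex` to `S.X₃`. -/
def spliceπ (S : ShortComplex A) (R : ProjectiveResolution S.X₁) :
    spliceComplex S R ⟶ (ChainComplex.single₀ A).obj S.X₃ :=
  (ChainComplex.toSingle₀Equiv _ _).symm ⟨S.g,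
    (Category.assoc _ _ _).trans ((congrArg _ S.zero).trans comp_zero)⟩

lemma spliceπ_f_zero (R : ProjectiveResolution S.X₁) : (spliceπ S R).f 0 = S.g :=
  ChainComplex.toSingle₀Equiv_symm_apply_f_zero _ _

lemma quasiIsoAt_spliceπ_zero (hS : S.ShortExact) (R : ProjectiveResolution S.X₁) :
    QuasiIsoAt (spliceπ S R) 0 := by
  rw [ChainComplex.quasiIsoAt₀_iff, ShortComplex.quasiIso_iff_of_zeros' _ rfl rfl rfl,
    ShortComplex.exact_and_epi_g_iff_of_iso
      (S₂ := ShortComplex.mk (R.augmentation ≫ S.f) S.g (by simp))]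
  · let φ : ShortComplex.mk (R.augmentation ≫ S.f) S.g (by simp) ⟶ S :=
      { τ₁ := R.augmentation, τ₂ := 𝟙 _, τ₃ := 𝟙 _ }
    have : Epi φ.τ₁ := inferInstanceAs (Epi R.augmentation)
    have : IsIso φ.τ₂ := inferInstanceAs (IsIso (𝟙 _))
    have : Mono φ.τ₃ := inferInstanceAs (Mono (𝟙 _))
    exact ⟨(ShortComplex.exact_iff_of_epi_of_isIso_of_mono φ).2 hS.exact, hS.epi_g⟩
  · exact ShortComplex.isoMk (Iso.refl _) (Iso.refl _) (Iso.refl _)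
      ((Category.id_comp _).trans (Category.comp_id _).symm)
      ((Category.id_comp _).trans ((spliceπ_f_zero R).symm.trans (Category.comp_id _).symm))

lemma exactAt_spliceComplex_succ (hS : S.ShortExact) (R : ProjectiveResolution S.X₁) (n : ℕ) :
    (spliceComplex S R).ExactAt (n + 1) := by
  rw [HomologicalComplex.exactAt_iff' _ (n + 2) (n + 1) n (by simp) (by simp)]
  cases n with
  | zero =>
    let φ : ShortComplex.mk _ _ R.d_augmentation ⟶ (spliceComplex S R).sc' 2 1 0 :=
      { τ₁ := 𝟙 _
        τ₂ := 𝟙 _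
        τ₃ := S.f
        comm₁₂ := (Category.id_comp _).trans (Category.comp_id _).symm
        comm₂₃ := Category.id_comp _ }
    have : Epi φ.τ₁ := inferInstanceAs (Epi (𝟙 _))
    have : IsIso φ.τ₂ := inferInstanceAs (IsIso (𝟙 _))
    have : Mono φ.τ₃ := hS.mono_f
    exact (ShortComplex.exact_iff_of_epi_of_isIso_of_mono φ).1 R.exact_augmentation
  | succ n => exact R.exact_succ n

/-- If `0 ⟶ S.X₁ ⟶ S.X₂ ⟶ S.X₃ ⟶ 0` is exact with `S.X₂` projective, a projective resolution
of `S.X₁` extends to a projective resolution of `S.X₃`. -/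
def splice (hS : S.ShortExact) [Projective S.X₂] (R : ProjectiveResolution S.X₁) :
    ProjectiveResolution S.X₃ where
  complex := spliceComplex S R
  projective n := by
    cases n
    · assumption
    · exact R.projective _
  π := spliceπ S R
  quasiIso := ⟨fun n => by
    cases n with
    | zero => exact quasiIsoAt_spliceπ_zero hS R
    | succ n =>
      rw [quasiIsoAt_iff_exactAt' _ _ (ChainComplex.exactAt_succ_single_obj _ _)]
      exact exactAt_spliceComplex_succ hS R n⟩

end CategoryTheory.ProjectiveResolution

namespace CategoryTheory.ShortComplex.ShortExact

variable {A : Type*} [Category A] [Abelian A] [HasProjectiveResolutions A]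
  {B : Type*} [Category B] [Abelian B] (F : A ⥤ B) [F.Additive]
  {S : ShortComplex A} (hS : S.ShortExact) [Projective S.X₂]

/-- Dimension shifting for left derived functors in degrees at least `2`. -/
def leftDerivedSuccSuccIso (n : ℕ) :
    (F.leftDerived (n + 2)).obj S.X₃ ≅ (F.leftDerived (n + 1)).obj S.X₁ :=
  ((projectiveResolution S.X₁).splice hS).isoLeftDerivedObj F (n + 2) ≪≫
    ShortComplex.homologyMapIso
      (HomologicalComplex.isoSc' _ (n + 3) (n + 2) (n + 1) (by simp) (by simp)) ≪≫
    (ShortComplex.homologyMapIso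
      (HomologicalComplex.isoSc' ((F.mapHomologicalComplex _).obj
        (projectiveResolution S.X₁).complex) (n + 2) (n + 1) n (by simp) (by simp))).symm ≪≫
    ((projectiveResolution S.X₁).isoLeftDerivedObj F (n + 1)).symm

/-- Dimension shifting for the first left derived functor of a right exact functor. -/
def leftDerivedOneIso [PreservesFiniteColimits F] :
    (F.leftDerived 1).obj S.X₃ ≅ kernel (F.map S.f) :=
  let R := projectiveResolution S.X₁
  have hR := R.exact_augmentation.map_of_epi_of_preservesCokernel F
    (inferInstanceAs (Epi R.augmentation)) inferInstance
  have : Epi ((ShortComplex.mk _ _ R.d_augmentation).map F).g :=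
    inferInstanceAs (Epi (F.map R.augmentation))
  (R.splice hS).isoLeftDerivedObj F 1 ≪≫
    ShortComplex.homologyMapIso (HomologicalComplex.isoSc' _ 2 1 0 (by simp) (by simp)) ≪≫
    ShortComplex.homologyIsoKernelOfIsColimit
      (((F.mapHomologicalComplex _).obj (R.splice hS).complex).sc' 2 1 0)
      (F.map R.augmentation) _ hR.gIsCokernel (F.map S.f)
      (F.map_comp _ _).symm

end CategoryTheory.ShortComplex.ShortExact

namespace CategoryTheory.ShortComplex

variable {A : Type*} [Category A] [Abelian A]

section

variable [EnoughProjectives A]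

/-- The split short complex of projective objects in the first step of the horseshoe lemma. -/
abbrev horseshoe (S : ShortComplex A) : ShortComplex A :=
  ShortComplex.mk (biprod.inl : Projective.over S.X₁ ⟶ _ ⊞ Projective.over S.X₃) biprod.snd
    biprod.inl_snd

/-- The epimorphism onto `S` in the first step of the horseshoe lemma. -/
def horseshoeπ (S : ShortComplex A) [Epi S.g] : S.horseshoe ⟶ S where
  τ₁ := Projective.π _
  τ₂ := biprod.desc (Projective.π _ ≫ S.f) (Projective.factorThru (Projective.π S.X₃) S.g)
  τ₃ := Projective.π _
  comm₂₃ := by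
    apply biprod.hom_ext' <;> simp


end

/-- Any morphism between short exact sequences gives an instance of the snake lemma. -/
def snakeInputOfHom {S T : ShortComplex A} (φ : S ⟶ T) (hS : S.Exact) (hg : Epi S.g)
    (hT : T.Exact) (hf : Mono T.f) : SnakeInput A where
  L₀ := kernel φ
  L₁ := S
  L₂ := T
  L₃ := cokernel φ
  v₀₁ := kernel.ι φ
  v₁₂ := φ
  v₂₃ := cokernel.π φ
  h₀ := kernelIsKernel φ
  h₃ := cokernelIsCokernel φ
  L₁_exact := hS
  epi_L₁_g := hg
  L₂_exact := hT
  mono_L₂_f := hf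

/-- A projective presentation of a short exact sequence by a split sequence of projectives. -/
structure HorseshoeData (S : ShortComplex A) where
  /-- the short complex of syzygies -/
  K : ShortComplex A
  /-- the short complex of projective objects -/
  T : ShortComplex A
  /-- the inclusion of the syzygies -/
  ι : K ⟶ T
  /-- the projection onto `S` -/
  π : T ⟶ S
  w : ι ≫ π = 0
  shortExact_K : K.ShortExact
  splitting : T.Splitting
  projective₁ : Projective T.X₁
  projective₂ : Projective T.X₂
  projective₃ : Projective T.X₃
  shortExact₁ : (ShortComplex.mk ι.τ₁ π.τ₁ (by rw [← comp_τ₁, w, zero_τ₁])).ShortExact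
  shortExact₂ : (ShortComplex.mk ι.τ₂ π.τ₂ (by rw [← comp_τ₂, w, zero_τ₂])).ShortExact
  shortExact₃ : (ShortComplex.mk ι.τ₃ π.τ₃ (by rw [← comp_τ₃, w, zero_τ₃])).ShortExact

attribute [instance] HorseshoeData.projective₁ HorseshoeData.projective₂
  HorseshoeData.projective₃

/-- The horseshoe lemma in one step. -/
def ShortExact.horseshoeData [EnoughProjectives A] {S : ShortComplex A} (hS : S.ShortExact) :
    HorseshoeData S :=
  have := hS.epi_g
  let s : S.horseshoe.Splitting := .ofHasBinaryBiproduct _ _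
  have hT := s.shortExact
  let I := snakeInputOfHom S.horseshoeπ hT.exact hT.epi_g hS.exact hS.mono_f
  have h₁ : Epi S.horseshoeπ.τ₁ := Projective.π_epi _
  have h₃ : Epi S.horseshoeπ.τ₃ := Projective.π_epi _
  have h₂ : Epi S.horseshoeπ.τ₂ :=
    epi_τ₂_of_exact_of_epi S.horseshoeπ hS.exact
  have : Mono I.L₁.f := hT.mono_f
  have hz : IsZero I.L₃.X₁ := IsZero.of_epi_eq_zero I.v₂₃.τ₁
      ((cancel_epi S.horseshoeπ.τ₁).1 (I.w₁₃_τ₁.trans comp_zero.symm))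
  { K := I.L₀
    T := S.horseshoe
    ι := I.v₀₁
    π := S.horseshoeπ
    w := I.w₀₂
    shortExact_K :=
      { exact := I.L₀_exact
        mono_f := inferInstance
        epi_g := I.L₁'_exact.epi_f (hz.eq_of_tgt _ _) }
    splitting := s
    projective₁ := Projective.projective_over _
    projective₂ := inferInstance
    projective₃ := Projective.projective_over _
    shortExact₁ := .mk' I.exact_C₁_up I.mono_v₀₁_τ₁ h₁
    shortExact₂ := .mk' I.exact_C₂_up I.mono_v₀₁_τ₂ h₂
    shortExact₃ := .mk' I.exact_C₃_up I.mono_v₀₁_τ₃ h₃ }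

variable {B : Type*} [Category B] [Abelian B] (F : A ⥤ B) [F.Additive] [PreservesFiniteColimits F]

/-- The snake diagram obtained by applying a right exact functor to a horseshoe. -/
def HorseshoeData.snakeInput {S : ShortComplex A} (H : HorseshoeData S) : SnakeInput B where
  L₀ := kernel (F.mapShortComplex.map H.ι)
  L₁ := F.mapShortComplex.obj H.K
  L₂ := F.mapShortComplex.obj H.T
  L₃ := F.mapShortComplex.obj S
  v₀₁ := kernel.ι _
  v₁₂ := F.mapShortComplex.map H.ι
  v₂₃ := F.mapShortComplex.map H.π
  w₁₃ := (F.mapShortComplex.map_comp _ _).symm.trans 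
    (by rw [H.w]; ext <;> exact F.map_zero _ _)
  h₀ := kernelIsKernel _
  h₃ := by
    apply isColimitOfIsColimitπ
    · have := H.shortExact₁.epi_g
      exact (CokernelCofork.isColimitMapCoconeEquiv _ _).symm
        (isColimitCoforkMapOfIsColimit' F _ H.shortExact₁.gIsCokernel)
    · have := H.shortExact₂.epi_g
      exact (CokernelCofork.isColimitMapCoconeEquiv _ _).symm
        (isColimitCoforkMapOfIsColimit' F _ H.shortExact₂.gIsCokernel)
    · have := H.shortExact₃.epi_g
      exact (CokernelCofork.isColimitMapCoconeEquiv _ _).symm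
        (isColimitCoforkMapOfIsColimit' F _ H.shortExact₃.gIsCokernel)
  L₁_exact := by
    have := H.shortExact_K.epi_g
    exact H.shortExact_K.exact.map_of_epi_of_preservesCokernel F inferInstance inferInstance
  epi_L₁_g := by
    have := H.shortExact_K.epi_g
    exact inferInstanceAs (Epi (F.map H.K.g))
  L₂_exact := (H.splitting.map F).exact
  mono_L₂_f := (H.splitting.map F).mono_f

section

variable {S : ShortComplex A} (H : HorseshoeData S) [HasProjectiveResolutions A]

/-- The top row of the snake diagram computes the first left derived functor. -/
def HorseshoeData.L₀X₁Iso : (H.snakeInput F).L₀.X₁ ≅ (F.leftDerived 1).obj S.X₁ :=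
  (H.snakeInput F).h₀τ₁.conePointUniqueUpToIso (kernelIsKernel _) ≪≫
    (H.shortExact₁.leftDerivedOneIso F).symm

/-- The top row of the snake diagram computes the first left derived functor. -/
def HorseshoeData.L₀X₂Iso : (H.snakeInput F).L₀.X₂ ≅ (F.leftDerived 1).obj S.X₂ :=
  (H.snakeInput F).h₀τ₂.conePointUniqueUpToIso (kernelIsKernel _) ≪≫
    (H.shortExact₂.leftDerivedOneIso F).symm

/-- The top row of the snake diagram computes the first left derived functor. -/
def HorseshoeData.L₀X₃Iso : (H.snakeInput F).L₀.X₃ ≅ (F.leftDerived 1).obj S.X₃ :=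
  (H.snakeInput F).h₀τ₃.conePointUniqueUpToIso (kernelIsKernel _) ≪≫
    (H.shortExact₃.leftDerivedOneIso F).symm

end

section

variable [EnoughProjectives A] {S : ShortComplex A}

lemma ShortExact.mono_map_of_isZero_leftDerived_one (hS : S.ShortExact)
    (h : IsZero ((F.leftDerived 1).obj S.X₃)) : Mono (F.map S.f) :=
  let H := hS.horseshoeData
  (H.snakeInput F).L₂'_exact.mono_g ((h.of_iso (H.L₀X₃Iso F)).eq_of_src _ _)

/-- The part of the long exact sequence of left derived functors to the right of a vanishing
term. -/
lemma ShortExact.exists_mono_leftDerived (n : ℕ) (hS : S.ShortExact)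
    (h : IsZero ((F.leftDerived (n + 1)).obj S.X₃)) :
    ∃ f : (F.leftDerived n).obj S.X₁ ⟶ (F.leftDerived n).obj S.X₂,
      Mono f ∧ (IsZero ((F.leftDerived n).obj S.X₃) → IsIso f) := by
  induction n generalizing S with
  | zero =>
    have := hS.mono_map_of_isZero_leftDerived_one F h
    refine exists_mono_of_iso (F.leftDerivedZeroIsoSelf.app S.X₁).symm
      (F.leftDerivedZeroIsoSelf.app S.X₂).symm (F.leftDerivedZeroIsoSelf.app S.X₃).symm
      ⟨F.map S.f, this, fun hz => ?_⟩
    have := hS.epi_g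
    have : Epi (F.map S.f) :=
      (hS.exact.map_of_epi_of_preservesCokernel F inferInstance inferInstance).epi_f
      (hz.eq_of_tgt _ _)
    exact isIso_of_mono_of_epi (F.map S.f)
  | succ n ih =>
    let H := hS.horseshoeData
    replace h := h.of_iso (H.shortExact₃.leftDerivedSuccSuccIso F n).symm
    cases n with
    | zero =>
      let I := H.snakeInput F
      have : Mono I.L₁.f := H.shortExact_K.mono_map_of_isZero_leftDerived_one F h
      refine exists_mono_of_iso (H.L₀X₁Iso F) (H.L₀X₂Iso F) (H.L₀X₃Iso F)
        ⟨I.L₀.f, inferInstance, fun hz => ?_⟩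
      have := I.L₀_exact.epi_f (hz.eq_of_tgt _ _)
      exact isIso_of_mono_of_epi I.L₀.f
    | succ n =>
      exact exists_mono_of_iso (H.shortExact₁.leftDerivedSuccSuccIso F n).symm
        (H.shortExact₂.leftDerivedSuccSuccIso F n).symm
        (H.shortExact₃.leftDerivedSuccSuccIso F n).symm (ih H.shortExact_K h)

end

end CategoryTheory.ShortComplex

namespace CategoryTheory.Functor

variable {A : Type*} [Category A] [Abelian A]
  {B : Type*} [Category B] [Abelian B]

instance [HasProjectiveResolutions A] (F : A ⥤ B) [F.Additive] (n : ℕ) : (F.leftDerived n).Additive where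
  map_add {X Y f g} := by
    let P := projectiveResolution X
    let Q := projectiveResolution Y
    rw [F.leftDerived_map_eq n f _ (ProjectiveResolution.lift_commutes f P Q),
      F.leftDerived_map_eq n g _ (ProjectiveResolution.lift_commutes g P Q),
      F.leftDerived_map_eq n (f + g)
        (ProjectiveResolution.lift f P Q + ProjectiveResolution.lift g P Q)
        (by rw [Preadditive.add_comp, ProjectiveResolution.lift_commutes,
          ProjectiveResolution.lift_commutes, ← Preadditive.comp_add, ← Functor.map_add]),
      Functor.map_add, Preadditive.add_comp, Preadditive.comp_add]

lemma isZero_obj_biproduct (G : A ⥤ B) [G.Additive] {ι : Type} [Fintype ι] (X : ι → A)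
    [HasBiproduct X] (h : ∀ i, IsZero (G.obj (X i))) : IsZero (G.obj (⨁ X)) := by
  rw [IsZero.iff_id_eq_zero, ← G.map_id, ← biproduct.total, G.map_sum]
  exact Finset.sum_eq_zero fun i _ => by rw [G.map_comp, (h i).eq_zero_of_src (G.map _), comp_zero]

end CategoryTheory.Functor

namespace HomologicalComplex

variable {A : Type*} [Category A] [Abelian A] {ι : Type*} {c : ComplexShape ι}
  (K : HomologicalComplex A c)

/-- The short complex `0 ⟶ Bⱼ ⟶ Kⱼ ⟶ opcycles ⟶ 0`, with `Bⱼ` the boundaries. -/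
abbrev boundariesShortComplex (j : ι) : ShortComplex A :=
  ShortComplex.mk (kernel.ι (K.pOpcycles j)) (K.pOpcycles j) (kernel.condition _)

lemma boundariesShortComplex_shortExact (j : ι) : (K.boundariesShortComplex j).ShortExact where
  exact := ShortComplex.exact_of_f_is_kernel _ (kernelIsKernel _)
  mono_f := inferInstanceAs (Mono (kernel.ι _))
  epi_g := inferInstanceAs (Epi (K.pOpcycles j))

lemma fromOpcycles_pOpcycles (i j : ι) : K.fromOpcycles i j ≫ K.pOpcycles j = 0 := by
  rw [← cancel_epi (K.pOpcycles i), p_fromOpcycles_assoc, d_pOpcycles, comp_zero]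

/-- The short complex `0 ⟶ Hᵢ ⟶ opcycles ⟶ Bⱼ ⟶ 0`, with `Bⱼ` the boundaries. -/
abbrev homologyShortComplex (i j : ι) : ShortComplex A :=
  ShortComplex.mk (K.homologyι i) (kernel.lift _ _ (K.fromOpcycles_pOpcycles i j))
    (by rw [← cancel_mono (kernel.ι _), Category.assoc, kernel.lift_ι,
      homologyι_comp_fromOpcycles, zero_comp])

lemma homologyShortComplex_shortExact {i j : ι} (hij : c.Rel i j) :
    (K.homologyShortComplex i j).ShortExact where
  exact := by
    have h : (ShortComplex.mk _ _ (K.homologyι_comp_fromOpcycles i j)).Exact :=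
      ShortComplex.exact_of_f_is_kernel _ (K.homologyIsKernel i j (c.next_eq' hij))
    let φ : K.homologyShortComplex i j ⟶ ShortComplex.mk _ _ (K.homologyι_comp_fromOpcycles i j) :=
      { τ₁ := 𝟙 _, τ₂ := 𝟙 _, τ₃ := kernel.ι _ }
    have : Epi φ.τ₁ := inferInstanceAs (Epi (𝟙 _))
    have : IsIso φ.τ₂ := inferInstanceAs (IsIso (𝟙 _))
    have : Mono φ.τ₃ := inferInstanceAs (Mono (kernel.ι _))
    exact (ShortComplex.exact_iff_of_epi_of_isIso_of_mono φ).2 h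
  mono_f := inferInstanceAs (Mono (K.homologyι i))
  epi_g := by
    have h : (ShortComplex.mk _ _ (K.d_pOpcycles i j)).Exact :=
      ShortComplex.exact_of_g_is_cokernel _ (K.opcyclesIsCokernel i j (c.prev_eq' hij))
    have := h.epi_kernelLift
    refine epi_of_epi_fac (f := K.pOpcycles i) (h := kernel.lift _ _ (K.d_pOpcycles i j)) ?_
    rw [← cancel_mono (kernel.ι _)]
    simp

variable {B : Type*} [Category B] [Abelian B] [EnoughProjectives A]
  (F : A ⥤ B) [F.Additive] [PreservesFiniteColimits F]

/-- If `L_(n+2) F` vanishes on the opcycles in degree `j`, then `L_n F` of the homology in the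
preceding degree embeds into `L_n F` of the opcycles; the embedding is an isomorphism if `n > 0`
and `L_(n+1) F` vanishes as well. -/
lemma exists_mono_leftDerived_homology {i j : ι} (hij : c.Rel i j) [Projective (K.X j)] (n : ℕ)
    (h : IsZero ((F.leftDerived (n + 2)).obj (K.opcycles j))) :
    ∃ f : (F.leftDerived n).obj (K.homology i) ⟶ (F.leftDerived n).obj (K.opcycles i),
      Mono f ∧ (0 < n → IsZero ((F.leftDerived (n + 1)).obj (K.opcycles j)) → IsIso f) := by
  have hB := K.boundariesShortComplex_shortExact j
  have : Projective (K.boundariesShortComplex j).X₂ := inferInstanceAs (Projective (K.X j))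
  obtain ⟨f, hf, hf'⟩ := (K.homologyShortComplex_shortExact hij).exists_mono_leftDerived F n
    (h.of_iso (hB.leftDerivedSuccSuccIso F n).symm)
  refine ⟨f, hf, fun hn h => hf' ?_⟩
  obtain ⟨n, rfl⟩ := Nat.exists_eq_succ_of_ne_zero hn.ne'
  exact h.of_iso (hB.leftDerivedSuccSuccIso F n).symm

/-- In a bounded below complex of projective objects whose homology objects are annihilated by
`L_n F` for all `n > d`, so are the opcycles. -/
lemma isZero_leftDerived_opcycles (P : ChainComplex A ℤ) [∀ i, Projective (P.X i)]
    {a : ℤ} (ha : ∀ i < a, IsZero (P.X i)) {d : ℕ}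
    (h : ∀ j : ℤ, ∀ n > d, IsZero ((F.leftDerived n).obj (P.homology j))) (j : ℤ) (n : ℕ)
    (hn : d < n) : IsZero ((F.leftDerived n).obj (P.opcycles j)) := by
  obtain hj | hj := lt_or_ge j a
  · exact Functor.map_isZero _ (IsZero.of_epi (P.pOpcycles j) (ha j hj))
  · have key : ∀ j ≥ a - 1, ∀ n > d, IsZero ((F.leftDerived n).obj (P.opcycles j)) := by
      intro j hj
      induction j, hj using Int.leInduction with
      | base =>
        exact fun n _ => Functor.map_isZero _ (IsZero.of_epi (P.pOpcycles _) (ha _ (by lia)))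
      | succ j hj ih =>
        intro n hn
        obtain ⟨f, -, hf⟩ := P.exists_mono_leftDerived_homology F (i := j + 1) (j := j) rfl n
          (ih _ (by lia))
        have := hf (by lia) (ih _ (by lia))
        exact (h _ n hn).of_iso (asIso f).symm
    exact key j (by lia) n hn

end HomologicalComplex

namespace QPD

variable {A : Type*} [Category A] [Abelian A]
  {B : Type*} [Category B] [Abelian B] (G : A ⥤ B) (M : A)

lemma isZero_obj_copies [G.Additive] (n : ℕ) (h : IsZero (G.obj M)) : IsZero (G.obj (copies M n)) :=
  G.isZero_obj_biproduct _ fun _ => h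

lemma isZero_obj_of_isZero_obj_copies [G.PreservesZeroMorphisms] {n : ℕ} (hn : n ≠ 0) (h : IsZero (G.obj (copies M n))) :
    IsZero (G.obj M) := by
  let i : Fin n := ⟨0, Nat.pos_of_ne_zero hn⟩
  let f : M ⟶ copies M n := biproduct.ι (fun _ : Fin n => M) i
  let g : copies M n ⟶ M := biproduct.π (fun _ : Fin n => M) i
  have hfg : f ≫ g = 𝟙 M := biproduct.ι_π_self _ i
  rw [IsZero.iff_id_eq_zero, ← G.map_id, ← hfg, G.map_comp, h.eq_zero_of_tgt (G.map f), zero_comp]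

end QPD

end

open QPD in
/-- (Proposition `general 3`(b) of the paper.) -/
theorem leftDerived_sup_of_finite_quasiProjRes {A : Type*} [Category A] [Abelian A]
    [EnoughProjectives A] {B : Type*} [Category B] [Abelian B]
    (M : A) (P : ChainComplex A ℤ)
    (hP : IsFiniteQuasiProjRes M P) (hhsup : IsHSup P 0)
    (F : A ⥤ B) [F.Additive] [PreservesFiniteColimits F]
    (d : ℕ)
    (hd : ¬ IsZero ((F.leftDerived d).obj M))
    (hd' : ∀ i : ℕ, d < i → IsZero ((F.leftDerived i).obj M)) :
    (¬ IsZero ((F.leftDerived d).obj (cokernel (P.d 1 0))) ∧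
      ∀ i : ℕ, d < i → IsZero ((F.leftDerived i).obj (cokernel (P.d 1 0)))) ∧
    (0 < d → Nonempty ((F.leftDerived d).obj (P.homology 0) ≅
      (F.leftDerived d).obj (cokernel (P.d 1 0)))) := by
  have := hP.projective
  obtain ⟨a, ha⟩ := hP.bddBelow
  obtain ⟨m, -, hm⟩ := hP.homology_iso
  have hz (j : ℤ) (n : ℕ) (hn : d < n) : IsZero ((F.leftDerived n).obj (P.opcycles j)) :=
    HomologicalComplex.isZero_leftDerived_opcycles F P ha (fun j n hn =>
      (isZero_obj_copies _ M (m j) (hd' n hn)).of_iso ((F.leftDerived n).mapIso (hm j).some)) j n hn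
  have e : cokernel (P.d 1 0) ≅ P.opcycles 0 :=
    (cokernelIsCokernel _).coconePointUniqueUpToIso (P.opcyclesIsCokernel 1 0 (by simp))
  obtain ⟨f, hf, hf'⟩ := P.exists_mono_leftDerived_homology F (i := 0) (j := -1) (by simp) d
    (hz _ _ (by lia))
  refine ⟨⟨fun h => hd ?_, fun n hn => (hz 0 n hn).of_iso ((F.leftDerived n).mapIso e)⟩,
    fun h => ?_⟩
  · have hm₀ : m 0 ≠ 0 := fun h₀ => hhsup.1 <| by
      refine IsZero.of_iso ?_ (hm 0).some
      rw [h₀, IsZero.iff_id_eq_zero]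
      exact biproduct.hom_ext _ _ fun i => i.elim0
    have h₁ := h.of_iso ((F.leftDerived d).mapIso e).symm
    exact isZero_obj_of_isZero_obj_copies _ M hm₀
      ((IsZero.of_mono f h₁).of_iso ((F.leftDerived d).mapIso (hm 0).some).symm)
  · have := hf' h (hz _ _ (by lia))
    exact ⟨asIso f ≪≫ ((F.leftDerived d).mapIso e).symm⟩
end

section
/- Let R be a left coherent ring and let M be a finitely presented left R-module whose quasi-projective dimension qpd_R(M) in the abelian category of finitely presented left R-modules is finite. Then there exists a finitely presented left R-module N such that pd_R(N) = qpd_R(M) and there is an injective R-module homomorphism M ↪ N. -/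
/-!
Quasi-projective dimension, following Gheibi–Jorgensen–Takahashi and
Chen–Chen–Liu, "Properties of quasi-projective dimension over abelian categories".
-/

open CategoryTheory CategoryTheory.Limits

attribute [local instance] CategoryTheory.Abelian.hasFiniteBiproducts

namespace QPD

variable {A : Type*} [Category A] [Abelian A]

/-- The embedding of `ℕ` into `ℤ`, as chain complex shapes, given by `n ↦ t + n`. -/
def embeddingDownIntGE (t : ℤ) :
    (ComplexShape.down ℕ).Embedding (ComplexShape.down ℤ) :=
  ComplexShape.Embedding.mk' _ _ (fun n => t + n)
    (fun _ _ h => Int.ofNat_inj.1 (add_left_cancel h)) (by simp; lia)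

@[simp]
lemma embeddingDownIntGE_f (t : ℤ) (n : ℕ) : (embeddingDownIntGE t).f n = t + n := rfl

instance (t : ℤ) : (embeddingDownIntGE t).IsRelIff where
  rel' i j h := by
    simp only [embeddingDownIntGE_f, ComplexShape.down_Rel] at h ⊢
    lia

/-- The embedding of `ℕ` into `ℤ`, from cochain to chain complex shapes, given by
`n ↦ k - n`. -/
def embeddingDownIntLE (k : ℤ) :
    (ComplexShape.up ℕ).Embedding (ComplexShape.down ℤ) :=
  ComplexShape.Embedding.mk' _ _ (fun n => k - n)
    (fun _ _ h => Int.ofNat_inj.1 (sub_right_injective h)) (by simp; lia)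

@[simp]
lemma embeddingDownIntLE_f (k : ℤ) (n : ℕ) : (embeddingDownIntLE k).f n = k - n := rfl

instance (k : ℤ) : (embeddingDownIntLE k).IsRelIff where
  rel' i j h := by
    simp only [embeddingDownIntLE_f, ComplexShape.down_Rel, ComplexShape.up_Rel] at h ⊢
    lia

instance (k : ℤ) : (embeddingDownIntLE k).IsTruncGE where
  mem_next {j k'} h := ⟨j + 1, by
    change k - ((j + 1 : ℕ) : ℤ) = k'
    change k' + 1 = k - (j : ℤ) at h
    push_cast; lia⟩

/-- The short exact sequence `0 ⟶ K.opcycles (i + 1) ⟶ K.X i ⟶ K.opcycles i ⟶ 0` when `K` is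
exact in degree `i + 1`. -/
lemma opcycles_shortExact (K : ChainComplex A ℤ) (i : ℤ) (h : K.ExactAt (i + 1)) :
    (ShortComplex.mk (K.fromOpcycles (i + 1) i) (K.pOpcycles i) (by
      rw [← cancel_epi (K.pOpcycles (i + 1)), HomologicalComplex.p_fromOpcycles_assoc,
        HomologicalComplex.d_pOpcycles, comp_zero])).ShortExact := by
  have hz : IsZero (K.homology (i + 1)) := (K.exactAt_iff_isZero_homology _).1 h
  have : Mono (K.fromOpcycles (i + 1) i) :=
    Preadditive.mono_of_isZero_kernel' _
      (K.homologyIsKernel (i + 1) i (ComplexShape.next_eq' _ (by simp))) hz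
  have hc := ShortComplex.exact_of_g_is_cokernel
    (ShortComplex.mk (K.d (i + 1) i) (K.pOpcycles i) (K.d_pOpcycles _ _))
    (K.opcyclesIsCokernel (i + 1) i (ComplexShape.prev_eq' _ (by simp)))
  refine { exact := ?_, mono_f := this, epi_g := by dsimp; infer_instance }
  let φ : ShortComplex.mk (K.d (i + 1) i) (K.pOpcycles i) (K.d_pOpcycles _ _) ⟶
      ShortComplex.mk (K.fromOpcycles (i + 1) i) (K.pOpcycles i) (by
      rw [← cancel_epi (K.pOpcycles (i + 1)), HomologicalComplex.p_fromOpcycles_assoc,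
        HomologicalComplex.d_pOpcycles, comp_zero]) :=
    { τ₁ := K.pOpcycles (i + 1)
      τ₂ := 𝟙 _
      τ₃ := 𝟙 _ }
  have : Epi φ.τ₁ := inferInstanceAs (Epi (K.pOpcycles (i + 1)))
  have : IsIso φ.τ₂ := inferInstanceAs (IsIso (𝟙 _))
  have : Mono φ.τ₃ := inferInstanceAs (Mono (𝟙 _))
  exact (ShortComplex.exact_iff_of_epi_of_isIso_of_mono φ).1 hc

lemma hasProjectiveDimensionLT_opcycles_iff (K : ChainComplex A ℤ)
    (hP : ∀ i, Projective (K.X i)) (m : ℕ) (a : ℤ) (hex : ∀ i, a < i → K.ExactAt i) :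
    HasProjectiveDimensionLT (K.opcycles a) (m + 1) ↔ Projective (K.opcycles (a + m)) := by
  induction m generalizing a with
  | zero => simpa using projective_iff_hasProjectiveDimensionLT_one.symm
  | succ m ih =>
    have h := (opcycles_shortExact K a (hex _ (by lia))).hasProjectiveDimensionLT_X₃_iff m
      (hP a)
    have h' := ih (a + 1) (fun i hi => hex i (by lia))
    rw [show a + ((m + 1 : ℕ) : ℤ) = a + 1 + m by push_cast; ring]
    exact h.trans h'

lemma hasProjectiveDimensionLT_of_resolution (Q : ChainComplex A ℤ) (n : ℕ) {N : A}
    (hP : ∀ i, Projective (Q.X i)) (hneg : ∀ i : ℤ, i < 0 → IsZero (Q.X i))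
    (hn : ∀ i : ℤ, (n : ℤ) < i → IsZero (Q.X i))
    (hex : ∀ i : ℤ, i ≠ 0 → IsZero (Q.homology i)) (e : Q.homology 0 ≅ N) :
    HasProjectiveDimensionLT N (n + 1) := by
  have h0 : Q.homology 0 ≅ Q.opcycles 0 :=
    Q.isoHomologyι 0 (-1) (ComplexShape.next_eq' _ (by simp))
      ((hneg (-1) (by simp)).eq_of_tgt _ _)
  have hiso : IsIso (Q.pOpcycles (n : ℤ)) :=
    Q.isIso_pOpcycles ((n : ℤ) + 1) n (ComplexShape.prev_eq' _ (by simp))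
      ((hn _ (by lia)).eq_of_src _ _)
  have hproj : Projective (Q.opcycles (0 + (n : ℤ))) := by
    rw [zero_add]
    have := hP n
    exact Projective.of_iso (asIso (Q.pOpcycles (n : ℤ))) this
  have := (hasProjectiveDimensionLT_opcycles_iff Q hP n 0 (fun i hi =>
    (Q.exactAt_iff_isZero_homology i).2 (hex i hi.ne'))).2 hproj
  exact hasProjectiveDimensionLT_of_iso (h0.symm ≪≫ e) _

/-- If a complex `K` of projectives is exact in degrees `> t` and vanishes in degrees `> t + n`,
its brutal truncation in degrees `≥ t` is a resolution of `K.opcycles t` of length `n`. -/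
lemma exists_resolution_opcycles (Q : A → Prop) (hQ : ∀ {X Y : A} (f : X ⟶ Y) [Epi f], Q X → Q Y)
    (K : ChainComplex A ℤ) (hP : ∀ i, Projective (K.X i)) (hKQ : ∀ i, Q (K.X i))
    (t : ℤ) (n : ℕ) (hex : ∀ i, t < i → IsZero (K.homology i))
    (hn : ∀ i, t + n < i → IsZero (K.X i)) :
    ∃ P : ChainComplex A ℤ, (∀ i, Projective (P.X i)) ∧ (∀ i, Q (P.X i)) ∧
      (∀ i : ℤ, i < 0 → IsZero (P.X i)) ∧ (∀ i : ℤ, (n : ℤ) < i → IsZero (P.X i)) ∧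
      (∀ i : ℤ, i ≠ 0 → IsZero (P.homology i)) ∧
      Nonempty (P.homology 0 ≅ K.opcycles t) := by
  let L : ChainComplex A ℕ := K.restriction (embeddingDownIntGE t)
  let e := embeddingDownIntGE 0
  have he (n : ℕ) : e.f n = n := zero_add _
  have hneg (i : ℤ) (hi : i < 0) (n : ℕ) : e.f n ≠ i := by rw [he]; lia
  have hL (i : ℕ) : Projective (L.X i) := hP _
  refine ⟨L.extend e, fun i => inferInstance, fun i => ?_,
    fun i hi => L.isZero_extend_X e i (hneg i hi), fun i hi => ?_, fun i hi => ?_, ⟨?_⟩⟩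
  · obtain hi | hi := lt_or_ge i 0
    · have := ((L.isZero_extend_X e i (hneg i hi))).epi (0 : K.X 0 ⟶ _)
      exact hQ (0 : K.X 0 ⟶ _) (hKQ 0)
    · lift i to ℕ using hi
      exact hQ (L.extendXIso e (he i)).inv (hKQ _)
  · lift i to ℕ using by lia
    exact (hn (t + i) (by lia)).of_iso (L.extendXIso e (he i))
  · obtain hi' | hi' := lt_or_ge i 0
    · exact (HomologicalComplex.exactAt_iff_isZero_homology _ _).1
        (ShortComplex.exact_of_isZero_X₂ _ (L.isZero_extend_X e i (hneg i hi')))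
    · lift i to ℕ using hi'
      obtain ⟨m, rfl⟩ : ∃ m, i = m + 1 := ⟨i - 1, by lia⟩
      refine (hex (t + (m + 1 : ℕ)) (by lia)).of_iso (L.extendHomologyIso e (he (m + 1)) ≪≫
        K.restrictionHomologyIso (embeddingDownIntGE t) (m + 2) (m + 1) m
          (by simp) (by simp) rfl rfl rfl ?_ ?_)
      · exact ComplexShape.prev_eq' _ (by change t + _ + 1 = t + _; push_cast; ring)
      · exact ComplexShape.next_eq' _ (by change t + _ + 1 = t + _; push_cast; ring)
  · exact L.extendHomologyIso e (he 0) ≪≫ L.isoHomologyι₀ ≪≫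
      K.restrictionOpcyclesIso (embeddingDownIntGE t) 1 0 (by simp) (i' := t + 1) (by simp)
        (by simp) (ComplexShape.prev_eq' _ (by simp))

/-- A finite quasi-projective resolution `K` with `hsup K = t ≤ k` and `K.opcycles k` projective
may be truncated in degree `k`. -/
lemma exists_truncation (Q : A → Prop) (hQ : ∀ {X Y : A} (f : X ⟶ Y) [Epi f], Q X → Q Y)
    {M : A} (K : ChainComplex A ℤ) (hK : IsFiniteQuasiProjRes M K) (hKQ : ∀ i, Q (K.X i))
    (t k : ℤ) (ht : IsHSup K t) (hk : t ≤ k) (hproj : Projective (K.opcycles k)) :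
    ∃ (P : ChainComplex A ℤ) (s : ℤ), IsFiniteQuasiProjRes M P ∧ (∀ i, Q (P.X i)) ∧
      IsSup P s ∧ IsHSup P t ∧ s ≤ k := by
  let e := embeddingDownIntLE k
  let P := K.truncGE e
  have hle (i : ℤ) (hi : i ≤ k) : e.f (k - i).toNat = i := by
    change k - ((k - i).toNat : ℤ) = i
    lia
  have hgt (i : ℤ) (hi : k < i) : ∀ n, e.f n ≠ i := fun n => by
    change k - (n : ℤ) ≠ i
    lia
  have hsupp : K.IsSupported e := ⟨fun i hi => (K.exactAt_iff_isZero_homology i).2 (ht.2 i (by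
    by_contra! h
    exact hi _ (hle i (h.trans hk))))⟩
  have : QuasiIso (K.πTruncGE e) := (K.quasiIso_πTruncGE_iff_isSupported e).2 hsupp
  have hH (i : ℤ) : K.homology i ≅ P.homology i := isoOfQuasiIsoAt (K.πTruncGE e) i
  have hzero (i : ℤ) (hi : k < i) : IsZero (P.X i) :=
    HomologicalComplex.isZero_X_of_isStrictlySupported P e i (hgt i hi)
  have hPQ (i : ℤ) : Q (P.X i) := hQ ((K.πTruncGE e).f i) (hKQ i)
  have hPproj (i : ℤ) : Projective (P.X i) := by
    obtain hi | hi := lt_or_ge k i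
    · have := hzero i hi
      exact Projective.of_iso ((isZero_zero A).iso this) inferInstance
    · by_cases hb : e.BoundaryGE (k - i).toNat
      · obtain rfl : i = k := by
          by_contra h
          refine hb.2 (k - (i + 1)).toNat ?_
          rw [hle _ hi, hle _ (by lia)]
          rfl
        exact Projective.of_iso (K.truncGEXIsoOpcycles e (hle i hi) hb).symm hproj
      · exact Projective.of_iso (K.truncGEXIso e (hle i hi) hb).symm (hK.projective i)
  have hbelow : ∃ a : ℤ, ∀ i, i < a → IsZero (P.X i) := by
    obtain ⟨a, ha⟩ := hK.bddBelow
    exact ⟨a, fun i hi => IsZero.of_epi ((K.πTruncGE e).f i) (ha i hi)⟩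
  have hhom : ∃ mult : ℤ → ℕ, (∃ j, mult j ≠ 0) ∧
      ∀ j, Nonempty (P.homology j ≅ copies M (mult j)) := by
    obtain ⟨mult, h, h'⟩ := hK.homology_iso
    refine ⟨mult, h, fun j => ?_⟩
    obtain ⟨φ⟩ := h' j
    exact ⟨(hH j).symm ≪≫ φ⟩
  have htP : IsHSup P t :=
    ⟨fun h => ht.1 (h.of_iso (hH t)), fun i hi => (ht.2 i hi).of_iso (hH i).symm⟩
  obtain ⟨s, hs, hs'⟩ := Int.exists_greatest_of_bdd (P := fun i => ¬ IsZero (P.X i))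
    ⟨k, fun i hi => not_lt.1 fun h => hi (hzero i h)⟩
    ⟨t, fun h => htP.1 ((HomologicalComplex.exactAt_iff_isZero_homology _ _).1
      (ShortComplex.exact_of_isZero_X₂ _ h))⟩
  exact ⟨P, s, ⟨⟨hPproj, hbelow, hhom⟩, k, hzero⟩, hPQ,
    ⟨hs, fun i hi => not_not.1 fun h => (hs' i h).not_gt hi⟩, htP,
    not_lt.1 fun h => hs (hzero s h)⟩

/-- An object of finite relative quasi-projective dimension embeds into the cokernel of a map
between projective objects satisfying `Q`, of relative projective dimension `qpdRel Q M`. -/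
theorem exists_mono_opcycles_of_qpdRel (Q : A → Prop)
    (hQ : ∀ {X Y : A} (f : X ⟶ Y) [Epi f], Q X → Q Y)
    {M : A} (hM : ¬ IsZero M) (hq : qpdRel Q M < ⊤) :
    ∃ (P : ChainComplex A ℤ) (t : ℤ) (f : M ⟶ P.opcycles t), Mono f ∧
      (∀ i, Projective (P.X i)) ∧ (∀ i, Q (P.X i)) ∧
      pdRel Q (P.opcycles t) = qpdRel Q M := by
  rw [qpdRel, if_neg hM] at hq ⊢
  set S := {d : ℕ∞ | ∃ (P : ChainComplex A ℤ) (s t : ℤ),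
    IsFiniteQuasiProjRes M P ∧ (∀ i, Q (P.X i)) ∧ IsSup P s ∧ IsHSup P t ∧
    d = ((s - t).toNat : ℕ∞)}
  have hne : S.Nonempty := by
    by_contra h
    rw [Set.not_nonempty_iff_eq_empty.1 h, sInf_empty] at hq
    exact lt_irrefl _ hq
  obtain ⟨P, s, t, hP, hPQ, hs, ht, hd⟩ := csInf_mem hne
  have hts : t ≤ s := not_lt.1 fun h => ht.1
    ((P.exactAt_iff_isZero_homology _).1 (ShortComplex.exact_of_isZero_X₂ _ (hs.2 t h)))
  obtain ⟨mult, -, hmult⟩ := hP.homology_iso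
  have hpos : mult t ≠ 0 := fun h => by
    refine ht.1 (IsZero.of_iso ?_ (hmult t).some)
    rw [h, copies, IsZero.iff_id_eq_zero]
    ext j
    exact j.elim0
  have : NeZero (mult t) := ⟨hpos⟩
  let ι : M ⟶ copies M (mult t) := biproduct.ι (fun _ : Fin (mult t) => M) 0
  have : Mono ι := inferInstanceAs (Mono (biproduct.ι (fun _ : Fin (mult t) => M) 0))
  refine ⟨P, t, (ι ≫ (hmult t).some.inv) ≫ P.homologyι t, mono_comp _ _, hP.projective, hPQ,
    le_antisymm ?_ ?_⟩
  · rw [hd]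
    exact sInf_le ⟨_, rfl, exists_resolution_opcycles Q hQ P hP.projective hPQ t _ ht.2
      (fun i hi => hs.2 i (by lia))⟩
  · refine le_sInf ?_
    rintro _ ⟨n, rfl, R, hR, -, hneg, hn, hex, ⟨e⟩⟩
    have hpd := hasProjectiveDimensionLT_of_resolution R n hR hneg hn hex e
    have hproj := (hasProjectiveDimensionLT_opcycles_iff P hP.projective n t
      (fun i hi => (P.exactAt_iff_isZero_homology i).2 (ht.2 i hi))).1 hpd
    obtain ⟨P', s', hP', hPQ', hs', ht', hle⟩ :=
      exists_truncation Q hQ P hP hPQ t (t + n) ht (by lia) hproj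
    have hmem : ((s' - t).toNat : ℕ∞) ∈ S := ⟨P', s', t, hP', hPQ', hs', ht', rfl⟩
    refine (sInf_le hmem).trans ?_
    exact Nat.cast_le.2 (by lia)

lemma pdRel_eq_zero_of_isZero (Q : A → Prop) {M : A} (hM : IsZero M)
    (hQ : ∀ X, IsZero X → Q X) : pdRel Q M = 0 := by
  let P : ChainComplex A ℤ := (HomologicalComplex.single A _ 0).obj M
  have hX (i : ℤ) : IsZero (P.X i) :=
    (HomologicalComplex.eval A (ComplexShape.down ℤ) i).map_isZero
      ((HomologicalComplex.single A (ComplexShape.down ℤ) 0).map_isZero hM)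
  have hH (i : ℤ) : IsZero (P.homology i) := (P.exactAt_iff_isZero_homology i).1
    (ShortComplex.exact_of_isZero_X₂ _ (hX i))
  exact nonpos_iff_eq_zero.1 (sInf_le ⟨0, rfl, P,
    fun i => Projective.of_iso ((isZero_zero A).iso (hX i)) inferInstance,
    fun i => hQ _ (hX i), fun i _ => hX i, fun i _ => hX i, fun i _ => hH i, ⟨(hH 0).iso hM⟩⟩)

lemma finitePresentation_opcycles {R : Type u} [Ring R] (P : ChainComplex (ModuleCat.{u} R) ℤ)
    (hP : ∀ i, Projective (P.X i)) (hfin : ∀ i, Module.Finite R (P.X i)) (t : ℤ) :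
    Module.FinitePresentation R (P.opcycles t) := by
  have := hfin t
  have := hfin (t + 1)
  have : Module.Projective R (P.X t) := (IsProjective.iff_projective _).2 (hP t)
  have : Module.FinitePresentation R (P.X t) := Module.finitePresentation_of_projective R _
  have hex : (ShortComplex.mk (P.d (t + 1) t) (P.pOpcycles t) (P.d_pOpcycles _ _)).Exact :=
    ShortComplex.exact_of_g_is_cokernel _
      (P.opcyclesIsCokernel (t + 1) t (ComplexShape.prev_eq' _ (by simp)))
  refine Module.finitePresentation_of_surjective (P.pOpcycles t).hom
    ((ModuleCat.epi_iff_surjective _).1 inferInstance) ?_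
  rw [← hex.moduleCat_range_eq_ker]
  have h : (Submodule.map (P.d (t + 1) t).hom ⊤).FG := Module.Finite.fg_top.map _
  rwa [Submodule.map_top] at h

end QPD

open QPD in
/-- Over a left coherent ring, a finitely presented module `M` of finite
quasi-projective dimension embeds into a finitely presented module `N` with
`pd N = qpd M`. -/
theorem exists_embedding_into_module_of_pd_eq_qpdFG {R : Type u} [Ring R]
    (hcoh : IsLeftCoherent R) (M : ModuleCat.{u} R) [Module.FinitePresentation R M]
    (hq : qpdFG M < ⊤) :
    ∃ N : ModuleCat.{u} R, Module.FinitePresentation R N ∧ pdFG N = qpdFG M ∧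
      ∃ f : M →ₗ[R] N, Function.Injective f := by
  by_cases hM : IsZero M
  · refine ⟨M, inferInstance, ?_, LinearMap.id, Function.injective_id⟩
    have h0 : qpdFG M = 0 := if_pos hM
    rw [h0]
    exact pdRel_eq_zero_of_isZero _ hM fun N hN =>
      have := ModuleCat.subsingleton_of_isZero hN
      (inferInstance : Module.Finite R N)
  · obtain ⟨P, t, f, hf, hP, hfin, h⟩ := exists_mono_opcycles_of_qpdRel
      (fun N : ModuleCat.{u} R => Module.Finite R N)
      (fun {X Y} (f : X ⟶ Y) _ hX => Module.Finite.of_surjective f.hom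
        ((ModuleCat.epi_iff_surjective f).1 inferInstance)) hM hq
    exact ⟨P.opcycles t, finitePresentation_opcycles P hP hfin t, h, f.hom,
      (ModuleCat.mono_iff_injective f).1 hf⟩
end
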